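/- Work in ℝ⁸ with standard basis e₁,…,e₈ and standard inner product. Let V = {v ∈ ℝ⁸ : ⟨v, e₆ − e₇⟩ = 0 and ⟨v, e₇ + e₈⟩ = 0}, and let Σ be the root system of type E₆ in V, namely Σ = {±e_i ± e_j : 1 ≤ j < i ≤ 5} ∪ {(1/2)Σ_{j=1}^{8} ε_j e_j : ε_j ∈ {1,−1}, the number of j with ε_j = −1 is even, and the vector lies in V}. For α ∈ Σ (all of which satisfy ⟨α,α⟩ = 2) let s_α(x) = x − ⟨x,α⟩α, and let W be the subgroup of linear isometries of ℝ⁸ generated by {s_α : α ∈ Σ}. Set ω₁ = (2/3)(e₈ − e₇ − e₆), ω₆ = e₅ + (1/3)(e₈ − e₇ − e₆), and K = {x ∈ V : |⟨x,α⟩| ≤ π/2 for all α ∈ Σ}. Then the set of extreme points of K equals {w((π/2)ω₁) : w ∈ W} ∪ {w((π/2)ω₆) : w ∈ W}, and these two W-orbits are disjoint. (This is Lemma 3.17.) -/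

import Mathlib

open Real
open scoped RealInnerProductSpace

namespace E6Boundary

/-- ℝ⁸ with its standard inner product. -/
abbrev E : Type := EuclideanSpace ℝ (Fin 8)

/-- The standard basis vectors e₁,…,e₈ (0-indexed as `e 0, …, e 7`). -/
noncomputable def e (i : Fin 8) : E := EuclideanSpace.single i (1 : ℝ)

/-- The subspace V = {v : ⟨v, e₆ − e₇⟩ = 0, ⟨v, e₇ + e₈⟩ = 0} containing
the root system E₆. -/
def V : Set E := {v : E | ⟪v, e 5 - e 6⟫ = 0 ∧ ⟪v, e 6 + e 7⟫ = 0}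

/-- The root system of type E₆:
{±e_i ± e_j : 1 ≤ j < i ≤ 5} together with the vectors
(1/2)Σ εⱼeⱼ, εⱼ = ±1, with an even number of minus signs, lying in V. -/
noncomputable def Sigma6 : Set E :=
  {x : E | ∃ s t : ℝ, (s = 1 ∨ s = -1) ∧ (t = 1 ∨ t = -1) ∧
      ∃ i j : Fin 8, j < i ∧ (i : ℕ) ≤ 4 ∧ x = s • e i + t • e j} ∪
  {x : E | ∃ ε : Fin 8 → ℝ, (∀ j, ε j = 1 ∨ ε j = -1) ∧
      Even ((Finset.univ.filter fun j => ε j = -1).card) ∧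
      x ∈ V ∧ x = (1 / 2 : ℝ) • ∑ j, ε j • e j}

/-- The Weyl group W generated by the reflections s_α(x) = x − ⟨x,α⟩α
(all roots α ∈ E₆ satisfy ⟨α,α⟩ = 2). -/
noncomputable def W : Subgroup (E ≃ₗᵢ[ℝ] E) :=
  Subgroup.closure
    {w : E ≃ₗᵢ[ℝ] E | ∃ α ∈ Sigma6, ∀ x : E, w x = x - ⟪x, α⟫ • α}

/-- The fundamental weight ω₁ = (2/3)(e₈ − e₇ − e₆). -/
noncomputable def ω₁ : E := (2 / 3 : ℝ) • (e 7 - e 6 - e 5)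

/-- The fundamental weight ω₆ = e₅ + (1/3)(e₈ − e₇ − e₆). -/
noncomputable def ω₆ : E := e 4 + (1 / 3 : ℝ) • (e 7 - e 6 - e 5)

/-- The closure K = Ω̄ of the polyhedron Ω in V attached to the root system E₆. -/
noncomputable def K : Set E :=
  {x : E | x ∈ V ∧ ∀ α ∈ Sigma6, |⟪x, α⟫| ≤ π / 2}

lemma inner8 (x y : E) : ⟪x, y⟫ = x 0 * y 0 + x 1 * y 1 + x 2 * y 2 + x 3 * y 3 + x 4 * y 4
    + x 5 * y 5 + x 6 * y 6 + x 7 * y 7 := by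
  simp [PiLp.inner_apply, Fin.sum_univ_eight, mul_comm]

lemma memV (x : E) : x ∈ V ↔ x 5 = x 6 ∧ x 6 = - x 7 := by
  simp only [V, Set.mem_ofPred_eq, inner8]
  simp [e]
  constructor
  · rintro ⟨h1, h2⟩; constructor <;> linarith
  · rintro ⟨h1, h2⟩; constructor <;> linarith

/-- Integer description of the (doubled) roots. -/
def IsRt (a : Fin 8 → ℤ) : Prop :=
  a 5 = a 6 ∧ a 6 = - a 7 ∧ (∀ i, (2 : ℤ) ∣ a i - a 0) ∧ (4 : ℤ) ∣ ∑ i, a i ∧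
    ∑ i, a i * a i = 8

instance (a : Fin 8 → ℤ) : Decidable (IsRt a) := by unfold IsRt; infer_instance

/-- The vector with coordinates `a i / 2`. -/
noncomputable def vec (a : Fin 8 → ℤ) : E := WithLp.toLp 2 (fun i => (a i : ℝ) / 2)

@[simp] lemma vec_apply (a : Fin 8 → ℤ) (i : Fin 8) : vec a i = (a i : ℝ) / 2 := rfl

/-- Doubled coordinates of `±e i ± e j`. -/
def pm (s t : ℤ) (i j : Fin 8) : Fin 8 → ℤ :=
  fun k => if k = i then 2 * s else if k = j then 2 * t else 0

lemma pm_isRt : ∀ i j : Fin 8, j < i → (i : ℕ) ≤ 4 →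
    IsRt (pm 1 1 i j) ∧ IsRt (pm 1 (-1) i j) ∧ IsRt (pm (-1) 1 i j) ∧ IsRt (pm (-1) (-1) i j) := by
  decide

lemma vec_pm (s t : ℤ) (i j : Fin 8) (h : j < i) :
    vec (pm s t i j) = (s : ℝ) • e i + (t : ℝ) • e j := by
  ext k
  by_cases h1 : k = i
  · subst h1; simp [pm, e, h.ne']
  · by_cases h2 : k = j
    · subst h2; simp [pm, e, h1]
    · simp [pm, e, h1, h2]

lemma half_sum (ε : Fin 8 → ℝ) (k : Fin 8) :
    ((1 / 2 : ℝ) • ∑ j, ε j • e j) k = ε k / 2 := by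
  simp [e, Fin.sum_univ_eight]
  fin_cases k <;> simp <;> ring

lemma root_exists {x : E} (hx : x ∈ Sigma6) : ∃ a, IsRt a ∧ x = vec a := by
  rcases hx with ⟨s, t, hs, ht, i, j, hij, hi, rfl⟩ | ⟨ε, hε, hev, hV, rfl⟩
  · obtain ⟨h1, h2, h3, h4⟩ := pm_isRt i j hij hi
    rcases hs with rfl | rfl <;> rcases ht with rfl | rfl
    · exact ⟨_, h1, by rw [vec_pm _ _ _ _ hij]; simp⟩
    · exact ⟨_, h2, by rw [vec_pm _ _ _ _ hij]; simp⟩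
    · exact ⟨_, h3, by rw [vec_pm _ _ _ _ hij]; simp⟩
    · exact ⟨_, h4, by rw [vec_pm _ _ _ _ hij]; simp⟩
  · have key : ∀ j, ∃ n : ℤ, (n = 1 ∨ n = -1) ∧ ε j = n := by
      intro j
      rcases hε j with h | h
      · exact ⟨1, Or.inl rfl, by simp [h]⟩
      · exact ⟨-1, Or.inr rfl, by simp [h]⟩
    choose a ha hεa using key
    have hsum : ∑ i, a i = 8 - 2 * ((Finset.univ.filter fun j => ε j = -1).card : ℤ) := by
      have h1 : ∀ i, a i = 1 - 2 * (if ε i = -1 then 1 else 0) := by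
        intro i
        rcases ha i with h | h
        · rw [hεa i, h]; norm_num
        · rw [hεa i, h]; norm_num
      rw [Finset.sum_congr rfl (fun i _ => h1 i), Finset.sum_sub_distrib, ← Finset.mul_sum]
      simp
    rw [memV] at hV
    simp only [half_sum, hεa] at hV
    refine ⟨a, ⟨?_, ?_, ?_, ?_, ?_⟩, ?_⟩
    · have := hV.1
      have h : (a 5 : ℝ) = a 6 := by linarith
      exact_mod_cast h
    · have := hV.2
      have h : (a 6 : ℝ) = -a 7 := by linarith
      exact_mod_cast h
    · intro i
      rcases ha i with h | h <;> rcases ha 0 with h' | h' <;> rw [h, h'] <;> decide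
    · rw [hsum]
      obtain ⟨r, hr⟩ := hev
      rw [hr]; push_cast; omega
    · have : ∀ i, a i * a i = 1 := by
        intro i
        rcases ha i with h | h <;> rw [h] <;> rfl
      simp [this]
    · ext k
      rw [half_sum, vec_apply, hεa]

lemma five (b : Fin 5 → ℤ) (hb : ∑ i, b i * b i = 2) :
    ∃ i j : Fin 5, j < i ∧ (b i = 1 ∨ b i = -1) ∧ (b j = 1 ∨ b j = -1) ∧
      ∀ k, k ≠ i → k ≠ j → b k = 0 := by
  have h : ∀ i, ∃ n : Fin 3, b i = (n : ℕ) - 1 := by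
    intro i
    have h1 : b i * b i ≤ 2 := by
      rw [← hb]
      exact Finset.single_le_sum (f := fun i => b i * b i) (fun i _ => mul_self_nonneg _)
        (Finset.mem_univ i)
    have h2 : b i ≤ 1 := by nlinarith
    have h3 : -1 ≤ b i := by nlinarith
    exact ⟨⟨(b i + 1).toNat, by omega⟩, by simp; omega⟩
  choose n hn using h
  obtain rfl : b = fun i => ((n i : ℕ) : ℤ) - 1 := funext hn
  clear hn
  revert n
  decide +kernel

lemma vec_mem {a : Fin 8 → ℤ} (h : IsRt a) : vec a ∈ Sigma6 := by
  obtain ⟨h5, h6, hp, h4, hn⟩ := h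
  rcases Int.even_or_odd (a 0) with h0 | h0
  · left
    have hb : ∀ i, ∃ c, a i = 2 * c := by
      intro i
      obtain ⟨r, hr⟩ := h0
      obtain ⟨q, hq⟩ := hp i
      exact ⟨q + r, by omega⟩
    choose b hb using hb
    have hb5 : b 5 = b 6 := by have := hb 5; have := hb 6; omega
    have hb6 : b 6 = - b 7 := by have := hb 7; have := hb 6; omega
    have hs : b 0 * b 0 + b 1 * b 1 + b 2 * b 2 + b 3 * b 3 + b 4 * b 4 + 3 * (b 7 * b 7) = 2 := by
      simp only [hb, Fin.sum_univ_eight] at hn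
      rw [hb5, hb6] at hn
      nlinarith
    have hb7 : b 7 = 0 := by
      by_contra h
      have : 0 < b 7 * b 7 := mul_self_pos.2 h
      nlinarith [mul_self_nonneg (b 0), mul_self_nonneg (b 1), mul_self_nonneg (b 2),
        mul_self_nonneg (b 3), mul_self_nonneg (b 4)]
    obtain ⟨i, j, hij, hi, hj, hk⟩ := five (fun i => b (Fin.castLE (by norm_num) i)) (by
      rw [hb7] at hs
      simp [Fin.sum_univ_five]
      linarith!)
    refine ⟨b (Fin.castLE (by norm_num) i), b (Fin.castLE (by norm_num) j), by exact_mod_cast hi, by exact_mod_cast hj,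
      Fin.castLE (by norm_num) i, Fin.castLE (by norm_num) j, by simpa using hij, by simp; omega, ?_⟩
    rw [← vec_pm _ _ _ _ (by simpa using hij)]
    congr 1
    ext k
    rw [hb k]
    simp only [pm]
    split_ifs with h1 h2
    · rw [h1]
    · rw [h2]
    · by_cases hk5 : (k : ℕ) < 5
      · have := hk ⟨k, hk5⟩ (by intro h; apply h1; ext; simp [← h]) (by intro h; apply h2; ext; simp [← h])
        have h' : b k = 0 := this
        rw [h']; rfl
      · have : k = 5 ∨ k = 6 ∨ k = 7 := by
          revert hk5; clear * -; revert k; decide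
        rcases this with rfl | rfl | rfl <;> omega
  · right
    have hsq : ∀ i, 1 ≤ a i * a i := by
      intro i
      have : a i ≠ 0 := by
        obtain ⟨r, hr⟩ := h0
        obtain ⟨q, hq⟩ := hp i
        omega
      have : 0 < a i * a i := mul_self_pos.2 this
      omega
    have hpm : ∀ i, a i = 1 ∨ a i = -1 := by
      have : ∀ i ∈ Finset.univ, (1:ℤ) = a i * a i := by
        rw [← Finset.sum_eq_sum_iff_of_le (fun i _ => hsq i)]
        simp [hn]
      intro i
      exact mul_self_eq_one_iff.1 (this i (Finset.mem_univ i)).symm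
    have hsum : ∑ i, a i = 8 - 2 * ((Finset.univ.filter fun j => (a j : ℝ) = -1).card : ℤ) := by
      have h1 : ∀ i, a i = 1 - 2 * (if (a i : ℝ) = -1 then 1 else 0) := by
        intro i
        rcases hpm i with h | h
        · rw [h]; norm_num
        · rw [h]; norm_num
      rw [Finset.sum_congr rfl (fun i _ => h1 i), Finset.sum_sub_distrib, ← Finset.mul_sum]
      simp
    refine ⟨fun j => a j, fun j => ?_, ?_, ?_, ?_⟩
    · rcases hpm j with h | h <;> simp [h]
    · rw [hsum] at h4
      rw [← Int.even_coe_nat]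
      obtain ⟨q, hq⟩ := h4
      refine ⟨2 - q, ?_⟩
      beta_reduce
      omega
    · rw [memV]; simp [h5, h6]; ring
    · ext k; rw [half_sum, vec_apply]

lemma root_inner (a b : Fin 8 → ℤ) : ⟪vec a, vec b⟫ = ((∑ i, a i * b i : ℤ) : ℝ) / 4 := by
  rw [inner8, Fin.sum_univ_eight]; push_cast; simp only [vec_apply]; ring

lemma four_dvd {a b : Fin 8 → ℤ} (ha : IsRt a) (hb : IsRt b) : (4 : ℤ) ∣ ∑ i, a i * b i := by
  obtain ⟨-, -, h1, h2, -⟩ := ha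
  obtain ⟨-, -, h3, h4, -⟩ := hb
  choose u hu using h1
  choose v hv using h3
  have hv' : ∀ i, b i = b 0 + 2 * v i := fun i => by linarith [hv i]
  have hu' : ∀ i, a i = a 0 + 2 * u i := fun i => by linarith [hu i]
  have e1 : ∑ i, a i * b i = b 0 * ∑ i, a i + a 0 * (∑ i, b i - 8 * b 0) + 4 * ∑ i, u i * v i := by
    generalize a 0 = a0 at *
    generalize b 0 = b0 at *
    simp only [hv', hu', Fin.sum_univ_eight]
    ring
  rw [e1]
  exact dvd_add (dvd_add (h2.mul_left _) ((dvd_sub h4 ⟨2 * b 0, by ring⟩).mul_left _)) ⟨_, rfl⟩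

lemma root_int {α β : E} (hα : α ∈ Sigma6) (hβ : β ∈ Sigma6) : ∃ n : ℤ, ⟪α, β⟫ = n := by
  obtain ⟨a, ha, rfl⟩ := root_exists hα
  obtain ⟨b, hb, rfl⟩ := root_exists hβ
  obtain ⟨k, hk⟩ := four_dvd ha hb
  exact ⟨k, by rw [root_inner, hk]; push_cast; ring⟩

lemma root_norm {α : E} (hα : α ∈ Sigma6) : ⟪α, α⟫ = (2 : ℝ) := by
  obtain ⟨a, ha, rfl⟩ := root_exists hα
  rw [root_inner, ha.2.2.2.2]; norm_num

lemma refl_root {α β : E} (hα : α ∈ Sigma6) (hβ : β ∈ Sigma6) : α - ⟪α, β⟫ • β ∈ Sigma6 := by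
  obtain ⟨a, ha, rfl⟩ := root_exists hα
  obtain ⟨b, hb, rfl⟩ := root_exists hβ
  obtain ⟨k, hk⟩ := four_dvd ha hb
  have e1 : vec a - ⟪vec a, vec b⟫ • vec b = vec (fun i => a i - k * b i) := by
    rw [root_inner, hk]
    ext i
    simp
    ring
  rw [e1]
  apply vec_mem
  obtain ⟨a5, a6, ap, a4, an⟩ := ha
  obtain ⟨b5, b6, bp, b4, bn⟩ := hb
  refine ⟨by simp only [a5, b5], by simp only [a6, b6]; ring, ?_, ?_, ?_⟩
  · intro i
    have : a i - k * b i - (a 0 - k * b 0) = (a i - a 0) - k * (b i - b 0) := by ring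
    rw [this]
    exact dvd_sub (ap i) ((bp i).mul_left _)
  · rw [Finset.sum_sub_distrib, ← Finset.mul_sum]
    exact dvd_sub a4 (b4.mul_left _)
  · have : ∑ i, (a i - k * b i) * (a i - k * b i) =
      ∑ i, a i * a i - 2 * k * ∑ i, a i * b i + k * k * ∑ i, b i * b i := by
      simp only [Fin.sum_univ_eight]; ring
    rw [this, an, bn, hk]; ring

lemma root_V {α : E} (hα : α ∈ Sigma6) : α ∈ V := by
  obtain ⟨a, ha, rfl⟩ := root_exists hα
  rw [memV]; simp [ha.1, ha.2.1]; ring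

lemma exists_refl {α : E} (hα : α ∈ Sigma6) : ∃ w ∈ W, ∀ x : E, w x = x - ⟪x, α⟫ • α := by
  have key : ∀ x : E, (Submodule.span ℝ {α})ᗮ.reflection x = x - ⟪x, α⟫ • α := by
    intro x
    rw [Submodule.reflection_orthogonal_apply, Submodule.reflection_singleton_apply]
    have h2 : (‖α‖ ^ 2 : ℝ) = 2 := by rw [← real_inner_self_eq_norm_sq, root_norm hα]
    simp [h2, real_inner_comm]
    module
  exact ⟨_, Subgroup.subset_closure ⟨α, hα, key⟩, key⟩

lemma refl_refl {α : E} (hα : α ∈ Sigma6) (x : E) :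
    (x - ⟪x, α⟫ • α) - ⟪x - ⟪x, α⟫ • α, α⟫ • α = x := by
  rw [inner_sub_left, inner_smul_left, root_norm hα]
  simp
  module

lemma W_pres (P : E → Prop) (hP : ∀ x, P x → ∀ β ∈ Sigma6, P (x - ⟪x, β⟫ • β)) :
    ∀ w ∈ W, ∀ x, P x ↔ P (w x) := by
  intro w hw
  induction hw using Subgroup.closure_induction with
  | mem w h =>
    obtain ⟨β, hβ, hw⟩ := h
    intro x
    rw [hw]
    refine ⟨fun h => hP x h β hβ, fun h => ?_⟩
    have := hP _ h β hβ
    rwa [refl_refl hβ] at this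
  | one => intro x; rfl
  | mul a b _ _ ha hb => intro x; rw [hb x, ha]; rfl
  | inv a _ ha => intro x; rw [ha (a⁻¹ x)]; simp

lemma W_root {w : E ≃ₗᵢ[ℝ] E} (hw : w ∈ W) {α : E} (hα : α ∈ Sigma6) : w α ∈ Sigma6 :=
  (W_pres (· ∈ Sigma6) (fun _ hx _ hβ => refl_root hx hβ) w hw α).1 hα

lemma refl_V {x β : E} (hx : x ∈ V) (hβ : β ∈ Sigma6) : x - ⟪x, β⟫ • β ∈ V := by
  have hb := root_V hβ
  rw [memV] at *
  generalize ⟪x, β⟫ = c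
  simp [hx.1, hx.2, hb.1, hb.2]
  ring

lemma refl_K {x β : E} (hx : x ∈ K) (hβ : β ∈ Sigma6) : x - ⟪x, β⟫ • β ∈ K := by
  refine ⟨refl_V hx.1 hβ, fun α hα => ?_⟩
  have := hx.2 _ (refl_root hα hβ)
  convert this using 2
  rw [inner_sub_left, inner_sub_right, inner_smul_left, inner_smul_right, real_inner_comm α β]
  simp [mul_comm]

lemma W_K {w : E ≃ₗᵢ[ℝ] E} (hw : w ∈ W) (x : E) : x ∈ K ↔ w x ∈ K :=
  W_pres (· ∈ K) (fun _ hx _ hβ => refl_K hx hβ) w hw x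

lemma Sigma6_finite : Sigma6.Finite := by
  have h : (Set.pi Set.univ (fun _ : Fin 8 => Set.Icc (-2 : ℤ) 2)).Finite :=
    Set.Finite.pi (fun _ => Set.finite_Icc _ _)
  refine (h.image vec).subset ?_
  intro x hx
  obtain ⟨a, ha, rfl⟩ := root_exists hx
  refine ⟨a, fun i _ => ?_, rfl⟩
  have h1 : a i * a i ≤ 8 := by
    rw [← ha.2.2.2.2]
    exact Finset.single_le_sum (f := fun i => a i * a i) (fun i _ => mul_self_nonneg _)
      (Finset.mem_univ i)
  constructor <;> nlinarith

/-- Simple roots (doubled). -/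
def sr : Fin 6 → Fin 8 → ℤ :=
  ![![1, -1, -1, -1, -1, -1, -1, 1], ![2, 2, 0, 0, 0, 0, 0, 0], ![-2, 2, 0, 0, 0, 0, 0, 0],
    ![0, -2, 2, 0, 0, 0, 0, 0], ![0, 0, -2, 2, 0, 0, 0, 0], ![0, 0, 0, -2, 2, 0, 0, 0]]

lemma sr_isRt : ∀ i, IsRt (sr i) := by decide

/-- Points of `V` in coordinates. -/
noncomputable def mk (a b c d f t : ℝ) : E := !₂[a, b, c, d, f, -t, -t, t]

lemma eq_mk {x : E} (hx : x ∈ V) : x = mk (x 0) (x 1) (x 2) (x 3) (x 4) (x 7) := by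
  rw [memV] at hx
  ext i
  fin_cases i <;> simp [mk, hx.1, hx.2]

lemma inner_mk (a b c d f t : ℝ) (r : Fin 8 → ℤ) : ⟪mk a b c d f t, vec r⟫ =
    (a * r 0 + b * r 1 + c * r 2 + d * r 3 + f * r 4 - t * r 5 - t * r 6 + t * r 7) / 2 := by
  rw [inner8]; simp [mk]; ring

lemma mk_span (a b c d f t : ℝ) : ∃ z : Fin 6 → ℝ, mk a b c d f t = ∑ i, z i • vec (sr i) := by
  refine ⟨![2 * t, (a - t + (b + t + (f + d + c + 3 * t))) / 2,
    ((b + t + (f + d + c + 3 * t)) - (a - t)) / 2, f + d + c + 3 * t, f + d + 2 * t, f + t], ?_⟩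
  ext i
  fin_cases i <;> simp [mk, Fin.sum_univ_six, sr] <;> ring

lemma orbit_finite {x : E} (hx : x ∈ V) : {y : E | ∃ w ∈ W, y = w x}.Finite := by
  rw [eq_mk hx]
  obtain ⟨z, hz⟩ := mk_span (x 0) (x 1) (x 2) (x 3) (x 4) (x 7)
  rw [hz]
  have h : (Set.pi Set.univ (fun _ : Fin 6 => Sigma6)).Finite :=
    Set.Finite.pi (fun _ => Sigma6_finite)
  refine (h.image (fun g => ∑ i, z i • g i)).subset ?_
  rintro y ⟨w, hw, rfl⟩
  exact ⟨fun i => w (vec (sr i)), fun i _ => W_root hw (vec_mem (sr_isRt i)), by simp⟩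

/-- A strictly dominant vector. -/
noncomputable def rho : E := mk 0 1 2 3 4 4

lemma exists_dominant {x : E} (hx : x ∈ V) : ∃ w ∈ W, ∀ i, 0 ≤ ⟪w x, vec (sr i)⟫ := by
  obtain ⟨y, ⟨w, hw, rfl⟩, hmax⟩ := Set.exists_max_image _ (fun y => ⟪y, rho⟫) (orbit_finite hx)
    ⟨x, 1, W.one_mem, rfl⟩
  refine ⟨w, hw, fun i => ?_⟩
  obtain ⟨s, hs, hsx⟩ := exists_refl (vec_mem (sr_isRt i))
  have := hmax _ ⟨s * w, W.mul_mem hs hw, rfl⟩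
  have h2 : (s * w) x = s (w x) := rfl
  rw [h2, hsx, inner_sub_left, inner_smul_left] at this
  have h1 : ⟪vec (sr i), rho⟫ = (1 : ℝ) := by
    rw [real_inner_comm, rho, inner_mk]
    fin_cases i <;> simp [sr] <;> norm_num
  rw [h1] at this
  simp at this
  exact this

/-- Orbits. -/
def orb (v : E) : Set E := {x : E | ∃ w ∈ W, x = (w : E ≃ₗᵢ[ℝ] E) v}

lemma orb_self (v : E) : v ∈ orb v := ⟨1, W.one_mem, rfl⟩

lemma orb_W {v x : E} (hx : x ∈ orb v) {w : E ≃ₗᵢ[ℝ] E} (hw : w ∈ W) : w x ∈ orb v := by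
  obtain ⟨u, hu, rfl⟩ := hx
  exact ⟨w * u, W.mul_mem hw hu, rfl⟩

lemma orb_smul {v x : E} (c : ℝ) (hx : x ∈ orb v) : c • x ∈ orb (c • v) := by
  obtain ⟨u, hu, rfl⟩ := hx
  exact ⟨u, hu, by simp⟩

lemma orb_step {v x y : E} (hx : x ∈ orb v) (r : Fin 8 → ℤ) (hr : IsRt r)
    (h1 : ⟪x, vec r⟫ = (1 : ℝ)) (hy : y = x - vec r) : y ∈ orb v := by
  obtain ⟨s, hs, hsx⟩ := exists_refl (vec_mem hr)
  have := orb_W hx hs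
  rw [hsx, h1, one_smul] at this
  rwa [hy]

lemma ω₁_eq : ω₁ = mk 0 0 0 0 0 (2 / 3) := by
  ext i
  fin_cases i <;> simp [ω₁, mk, e]

lemma ω₆_eq : ω₆ = mk 0 0 0 0 1 (1 / 3) := by
  ext i
  fin_cases i <;> simp [ω₆, mk, e]

lemma mk_sub_vec (a b c d f t : ℝ) (r : Fin 8 → ℤ) (hr : IsRt r) : mk a b c d f t - vec r =
    mk (a - r 0 / 2) (b - r 1 / 2) (c - r 2 / 2) (d - r 3 / 2) (f - r 4 / 2) (t - r 7 / 2) := by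
  ext i
  have h1 := hr.1
  have h2 := hr.2.1
  fin_cases i <;> simp [mk, h1, h2]
  all_goals ring

lemma orb_step_mk {v : E} {a b c d f t a' b' c' d' f' t' : ℝ} (hx : mk a b c d f t ∈ orb v)
    (r : Fin 8 → ℤ) (hr : IsRt r)
    (h1 : (a * r 0 + b * r 1 + c * r 2 + d * r 3 + f * r 4 - t * r 5 - t * r 6 + t * r 7) / 2 = 1)
    (ha : a' = a - r 0 / 2) (hb : b' = b - r 1 / 2) (hc : c' = c - r 2 / 2) (hd : d' = d - r 3 / 2)
    (hf : f' = f - r 4 / 2) (ht : t' = t - r 7 / 2) : mk a' b' c' d' f' t' ∈ orb v := by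
  refine orb_step hx r hr (by rw [inner_mk, h1]) ?_
  rw [mk_sub_vec _ _ _ _ _ _ _ hr, ha, hb, hc, hd, hf, ht]

lemma w1 : mk 0 0 0 0 0 (2 / 3) ∈ orb ω₁ := by rw [ω₁_eq]; exact orb_self _
lemma w6 : mk 0 0 0 0 1 (1 / 3) ∈ orb ω₆ := by rw [ω₆_eq]; exact orb_self _

lemma p1 : mk (-1/2) (1/2) (1/2) (1/2) (1/2) (1/6) ∈ orb ω₁ := by
  apply orb_step_mk w1 ![1, -1, -1, -1, -1, -1, -1, 1] (by decide) <;>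
    first | (simp; done) | (simp; norm_num)
lemma p3 : mk (1/2) (-1/2) (1/2) (1/2) (1/2) (1/6) ∈ orb ω₁ := by
  apply orb_step_mk w1 ![-1, 1, -1, -1, -1, -1, -1, 1] (by decide) <;>
    first | (simp; done) | (simp; norm_num)
lemma p6 : mk 0 0 0 1 0 (1/3) ∈ orb ω₆ := by
  apply orb_step_mk w6 ![0, 0, 0, -2, 2, 0, 0, 0] (by decide) <;>
    first | (simp; done) | (simp; norm_num)
lemma p2 : mk (1/2) (1/2) (1/2) (1/2) (-1/2) (1/6) ∈ orb ω₁ := by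
  apply orb_step_mk w1 ![-1, -1, -1, -1, 1, -1, -1, 1] (by decide) <;>
    first | (simp; done) | (simp; norm_num)
lemma p4 : mk (1/2) (1/2) (1/2) (-1/2) (1/2) (1/6) ∈ orb ω₁ := by
  apply orb_step_mk w1 ![-1, -1, -1, 1, -1, -1, -1, 1] (by decide) <;>
    first | (simp; done) | (simp; norm_num)
lemma q1 : mk 0 0 0 0 (-1) (-1/3) ∈ orb ω₁ := by
  apply orb_step_mk p2 ![1, 1, 1, 1, 1, -1, -1, 1] (by decide) <;>
    first | (simp; done) | (simp; norm_num)
lemma q2 : mk 0 0 0 0 1 (-1/3) ∈ orb ω₁ := by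
  apply orb_step_mk p4 ![1, 1, 1, -1, -1, -1, -1, 1] (by decide) <;>
    first | (simp; done) | (simp; norm_num)

/-- The convex hull of the two orbits. -/
noncomputable def C : Set E := convexHull ℝ (orb ((π / 2) • ω₁) ∪ orb ((π / 2) • ω₆))

lemma C1 {x : E} (hx : x ∈ orb ω₁) : (π / 2) • x ∈ C :=
  subset_convexHull _ _ (Or.inl (orb_smul _ hx))

lemma C6 {x : E} (hx : x ∈ orb ω₆) : (π / 2) • x ∈ C :=
  subset_convexHull _ _ (Or.inr (orb_smul _ hx))

lemma C_convex : Convex ℝ C := convex_convexHull _ _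

lemma C_W {w : E ≃ₗᵢ[ℝ] E} (hw : w ∈ W) {x : E} (hx : x ∈ C) : w x ∈ C := by
  have hc : Convex ℝ (w.toLinearEquiv.toLinearMap ⁻¹' C) := C_convex.linear_preimage _
  have : C ⊆ w.toLinearEquiv.toLinearMap ⁻¹' C := by
    refine convexHull_min ?_ hc
    rintro y (hy | hy)
    · exact subset_convexHull _ _ (Or.inl (orb_W hy hw))
    · exact subset_convexHull _ _ (Or.inr (orb_W hy hw))
  exact this hx

lemma C_two {x y z : E} (hx : (π / 2) • x ∈ C) (hy : (π / 2) • y ∈ C)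
    (h : z = (1 / 2 : ℝ) • x + (1 / 2 : ℝ) • y) : (π / 2) • z ∈ C := by
  have := C_convex hx hy (a := 1 / 2) (b := 1 / 2) (by norm_num) (by norm_num) (by norm_num)
  rw [h]
  convert this using 1
  module

lemma C_three {x y u z : E} (hx : (π / 2) • x ∈ C) (hy : (π / 2) • y ∈ C) (hu : (π / 2) • u ∈ C)
    (h : z = (1 / 3 : ℝ) • x + (1 / 3 : ℝ) • y + (1 / 3 : ℝ) • u) : (π / 2) • z ∈ C := by
  have h1 := C_convex hx hy (a := 1 / 2) (b := 1 / 2) (by norm_num) (by norm_num) (by norm_num)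
  have := C_convex h1 hu (a := 2 / 3) (b := 1 / 3) (by norm_num) (by norm_num) (by norm_num)
  rw [h]
  convert this using 1
  module

lemma mk_add (a b c d f t a' b' c' d' f' t' : ℝ) : mk a b c d f t + mk a' b' c' d' f' t' =
    mk (a + a') (b + b') (c + c') (d + d') (f + f') (t + t') := by
  ext i
  fin_cases i <;> simp [mk]
  all_goals ring

lemma mk_smul (k a b c d f t : ℝ) : k • mk a b c d f t =
    mk (k * a) (k * b) (k * c) (k * d) (k * f) (k * t) := by
  ext i
  fin_cases i <;> simp [mk]

lemma c0 : (π / 2) • mk 0 0 0 0 0 0 ∈ C :=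
  C_three (C1 w1) (C1 q1) (C1 q2) (by simp only [mk_add, mk_smul]; norm_num)
lemma c2 : (π / 2) • mk (1/4) (1/4) (1/4) (1/4) (1/4) (1/4) ∈ C :=
  C_two (C1 p2) (C6 w6) (by simp only [mk_add, mk_smul]; norm_num)
lemma c3 : (π / 2) • mk (-1/4) (1/4) (1/4) (1/4) (1/4) (5/12) ∈ C :=
  C_two (C1 w1) (C1 p1) (by simp only [mk_add, mk_smul]; norm_num)
lemma c4 : (π / 2) • mk 0 0 (1/3) (1/3) (1/3) (1/3) ∈ C :=
  C_three (C1 w1) (C1 p1) (C1 p3) (by simp only [mk_add, mk_smul]; norm_num)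
lemma c5 : (π / 2) • mk 0 0 0 (1/2) (1/2) (1/3) ∈ C :=
  C_two (C6 w6) (C6 p6) (by simp only [mk_add, mk_smul]; norm_num)

lemma alcove {n : Fin 7 → ℝ} (h0 : ∀ i, 0 ≤ n i) (h1 : ∑ i, n i = 1) :
    ∑ i, n i • ((π / 2) • (![mk 0 0 0 0 0 0, mk 0 0 0 0 0 (2/3),
      mk (1/4) (1/4) (1/4) (1/4) (1/4) (1/4), mk (-1/4) (1/4) (1/4) (1/4) (1/4) (5/12),
      mk 0 0 (1/3) (1/3) (1/3) (1/3), mk 0 0 0 (1/2) (1/2) (1/3),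
      mk 0 0 0 0 1 (1/3)] : Fin 7 → E) i) ∈ C := by
  refine C_convex.sum_mem (fun i _ => h0 i) h1 (fun i _ => ?_)
  fin_cases i
  exacts [c0, C1 w1, c2, c3, c4, c5, C6 w6]

lemma dominant_mem {x : E} (hx : x ∈ K) (hd : ∀ i, 0 ≤ ⟪x, vec (sr i)⟫) : x ∈ C := by
  have hθ := hx.2 _ (vec_mem (a := ![1, 1, 1, 1, 1, -1, -1, 1]) (by decide))
  have hm := eq_mk hx.1
  generalize x 0 = a at hm
  generalize x 1 = b at hm
  generalize x 2 = c at hm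
  generalize x 3 = d at hm
  generalize x 4 = f at hm
  generalize x 7 = t at hm
  subst hm
  have d1 := hd 0
  have d2 := hd 1
  have d3 := hd 2
  have d4 := hd 3
  have d5 := hd 4
  have d6 := hd 5
  rw [inner_mk] at d1 d2 d3 d4 d5 d6 hθ
  replace hθ := (abs_le.1 hθ).2
  simp [sr] at d1 d2 d3 d4 d5 d6 hθ
  have hp : 0 < π / 2 := by positivity
  have hp' := pi_pos
  set c1 := (a - b - c - d - f + 3 * t) / 2 with hc1
  have key := alcove (n := ![1 - (a + b + c + d + f + 3 * t) / 2 / (π / 2), c1 / (π / 2),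
    2 * (a + b) / (π / 2), 2 * (b - a) / (π / 2), 3 * (c - b) / (π / 2), 2 * (d - c) / (π / 2),
    (f - d) / (π / 2)]) ?_ ?_
  · convert key using 1
    simp [Fin.sum_univ_succ, mk_smul, mk_add]
    congr 1 <;> field_simp <;> ring
  · intro i
    fin_cases i
    · simp only [Fin.zero_eta, Matrix.cons_val_zero, sub_nonneg]
      rw [div_le_one hp]; linarith
    all_goals
      refine div_nonneg ?_ hp.le
      linarith
  · simp [Fin.sum_univ_succ]
    field_simp
    ring

lemma K_subset_C : K ⊆ C := by
  intro x hx
  obtain ⟨w, hw, hd⟩ := exists_dominant hx.1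
  have := C_W (W.inv_mem hw) (dominant_mem ((W_K hw x).1 hx) hd)
  simpa using this

lemma K_convex : Convex ℝ K := by
  intro x hx y hy a b ha hb hab
  have h1 := hx.1
  have h2 := hy.1
  refine ⟨?_, fun α hα => ?_⟩
  · rw [memV] at *
    simp [h1.1, h1.2, h2.1, h2.2]; ring
  · have h3 := abs_le.1 (hx.2 α hα)
    have h4 := abs_le.1 (hy.2 α hα)
    rw [inner_add_left, inner_smul_left, inner_smul_left, abs_le]
    simp only [conj_trivial]
    obtain rfl : b = 1 - a := by linarith
    constructor <;> nlinarith

lemma mk_mem_K {v : E} (hv : v ∈ V) (h : ∀ r, IsRt r → |⟪v, vec r⟫| ≤ 1) : (π / 2) • v ∈ K := by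
  refine ⟨?_, fun α hα => ?_⟩
  · rw [memV] at *
    simp [hv.1, hv.2]
  · obtain ⟨a, ha, rfl⟩ := root_exists hα
    rw [inner_smul_left, abs_mul]
    simp only [conj_trivial]
    rw [abs_of_pos (by positivity : 0 < π / 2)]
    have := h a ha
    nlinarith [pi_pos]

lemma mk_V (a b c d f t : ℝ) : mk a b c d f t ∈ V := by
  rw [memV]; simp [mk]

lemma rt_bounds {r : Fin 8 → ℤ} (hr : IsRt r) : r 5 = - r 7 ∧ r 6 = - r 7 ∧ -1 ≤ r 7 ∧ r 7 ≤ 1 ∧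
    -2 ≤ r 4 + r 7 ∧ r 4 + r 7 ≤ 2 := by
  obtain ⟨h5, h6, hp, -, hn⟩ := hr
  rw [Fin.sum_univ_eight, h5, h6] at hn
  have : r 4 * r 4 + 3 * (r 7 * r 7) ≤ 8 := by
    nlinarith [mul_self_nonneg (r 0), mul_self_nonneg (r 1), mul_self_nonneg (r 2),
      mul_self_nonneg (r 3)]
  have a1 : -1 ≤ r 7 := by nlinarith [mul_self_nonneg (r 4)]
  have a2 : r 7 ≤ 1 := by nlinarith [mul_self_nonneg (r 4)]
  have a3 : -2 ≤ r 4 := by nlinarith [mul_self_nonneg (r 7)]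
  have a4 : r 4 ≤ 2 := by nlinarith [mul_self_nonneg (r 7)]
  have b1 := hp 4
  have b2 := hp 7
  exact ⟨by rw [h5, h6], h6, a1, a2, by omega, by omega⟩

lemma ω₁_K : (π / 2) • ω₁ ∈ K := by
  rw [ω₁_eq]
  refine mk_mem_K (mk_V _ _ _ _ _ _) fun r hr => ?_
  obtain ⟨h5, h6, h1, h2, -, -⟩ := rt_bounds hr
  rw [inner_mk, h5, h6, abs_le]
  have h1' : (-1 : ℝ) ≤ r 7 := by exact_mod_cast h1
  have h2' : (r 7 : ℝ) ≤ 1 := by exact_mod_cast h2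
  push_cast
  constructor <;> linarith

lemma ω₆_K : (π / 2) • ω₆ ∈ K := by
  rw [ω₆_eq]
  refine mk_mem_K (mk_V _ _ _ _ _ _) fun r hr => ?_
  obtain ⟨h5, h6, -, -, h1, h2⟩ := rt_bounds hr
  rw [inner_mk, h5, h6, abs_le]
  have h1' : (-2 : ℝ) ≤ r 4 + r 7 := by exact_mod_cast h1
  have h2' : (r 4 + r 7 : ℝ) ≤ 2 := by exact_mod_cast h2
  push_cast
  constructor <;> linarith

lemma extreme_of_tight {v : E} (hv : v ∈ K)
    (h : ∀ y ∈ V, (∀ r, IsRt r → ⟪v, vec r⟫ = π / 2 → ⟪y, vec r⟫ = π / 2) → y = v) :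
    v ∈ Set.extremePoints ℝ K := by
  rw [mem_extremePoints_iff_left]
  refine ⟨hv, fun y hy z hz hyz => h y hy.1 fun r hr hvr => ?_⟩
  obtain ⟨a, b, ha, hb, hab, rfl⟩ := hyz
  have h1 := (abs_le.1 (hy.2 _ (vec_mem hr))).2
  have h2 := (abs_le.1 (hz.2 _ (vec_mem hr))).2
  rw [inner_add_left, inner_smul_left, inner_smul_left] at hvr
  simp only [conj_trivial] at hvr
  refine le_antisymm h1 ?_
  obtain rfl : b = 1 - a := by linarith
  by_contra hlt
  push Not at hlt
  nlinarith [mul_pos ha (sub_pos.2 hlt), mul_nonneg hb.le (sub_nonneg.2 h2)]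

lemma ω₁_ext : (π / 2) • ω₁ ∈ Set.extremePoints ℝ K := by
  refine extreme_of_tight ω₁_K fun y hy h => ?_
  have hm := eq_mk hy
  generalize y 0 = a at hm
  generalize y 1 = b at hm
  generalize y 2 = c at hm
  generalize y 3 = d at hm
  generalize y 4 = f at hm
  generalize y 7 = t at hm
  subst hm
  rw [ω₁_eq, mk_smul] at *
  simp only [inner_mk] at h
  have t1 := h ![1, 1, 1, 1, 1, -1, -1, 1] (by decide) (by simp; ring)
  have t2 := h ![-1, -1, 1, 1, 1, -1, -1, 1] (by decide) (by simp; ring)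
  have t3 := h ![-1, 1, -1, 1, 1, -1, -1, 1] (by decide) (by simp; ring)
  have t4 := h ![1, -1, -1, 1, 1, -1, -1, 1] (by decide) (by simp; ring)
  have t5 := h ![-1, 1, 1, -1, 1, -1, -1, 1] (by decide) (by simp; ring)
  have t6 := h ![-1, 1, 1, 1, -1, -1, -1, 1] (by decide) (by simp; ring)
  simp at t1 t2 t3 t4 t5 t6
  congr 1 <;> linarith

lemma ω₆_ext : (π / 2) • ω₆ ∈ Set.extremePoints ℝ K := by
  refine extreme_of_tight ω₆_K fun y hy h => ?_
  have hm := eq_mk hy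
  generalize y 0 = a at hm
  generalize y 1 = b at hm
  generalize y 2 = c at hm
  generalize y 3 = d at hm
  generalize y 4 = f at hm
  generalize y 7 = t at hm
  subst hm
  rw [ω₆_eq, mk_smul] at *
  simp only [inner_mk] at h
  have t1 := h ![1, 1, 1, 1, 1, -1, -1, 1] (by decide) (by simp; ring)
  have t2 := h ![2, 0, 0, 0, 2, 0, 0, 0] (by decide) (by simp)
  have t3 := h ![-2, 0, 0, 0, 2, 0, 0, 0] (by decide) (by simp)
  have t4 := h ![0, 2, 0, 0, 2, 0, 0, 0] (by decide) (by simp)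
  have t5 := h ![0, 0, 2, 0, 2, 0, 0, 0] (by decide) (by simp)
  have t6 := h ![0, 0, 0, 2, 2, 0, 0, 0] (by decide) (by simp)
  simp at t1 t2 t3 t4 t5 t6
  congr 1 <;> linarith

lemma ext_W {x : E} (hx : x ∈ Set.extremePoints ℝ K) {w : E ≃ₗᵢ[ℝ] E} (hw : w ∈ W) :
    w x ∈ Set.extremePoints ℝ K := by
  rw [mem_extremePoints_iff_left] at *
  refine ⟨(W_K hw x).1 hx.1, fun y hy z hz hyz => ?_⟩
  have hw' := W.inv_mem hw
  have := hx.2 (w⁻¹ y) ((W_K hw' y).1 hy) (w⁻¹ z) ((W_K hw' z).1 hz) ?_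
  · rw [← this]; simp
  · obtain ⟨a, b, ha, hb, hab, hh⟩ := hyz
    refine ⟨a, b, ha, hb, hab, ?_⟩
    have h2 : w⁻¹ (w x) = x := by simp
    rw [← h2, ← hh]; simp

/-- Invariant separating the orbits. -/
def Inv (c : ℝ) (x : E) : Prop :=
  (∀ α ∈ Sigma6, ∃ n : ℤ, ⟪x, α⟫ = n) ∧ ∃ n : ℤ, 2 * x 7 = c + n

lemma Inv_refl {c : ℝ} {x : E} (hx : Inv c x) {β : E} (hβ : β ∈ Sigma6) :
    Inv c (x - ⟪x, β⟫ • β) := by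
  obtain ⟨h1, m, hm⟩ := hx
  obtain ⟨k, hk⟩ := h1 β hβ
  refine ⟨fun α hα => ?_, ?_⟩
  · obtain ⟨n, hn⟩ := h1 α hα
    obtain ⟨l, hl⟩ := root_int hβ hα
    refine ⟨n - k * l, ?_⟩
    rw [inner_sub_left, inner_smul_left, hn, hl, hk]
    simp
  · obtain ⟨b, hb, rfl⟩ := root_exists hβ
    refine ⟨m - k * b 7, ?_⟩
    rw [hk]
    simp
    linarith

lemma Inv_orb {c : ℝ} {v x : E} (hv : Inv c v) (hx : x ∈ orb v) : Inv c x := by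
  obtain ⟨w, hw, rfl⟩ := hx
  exact (W_pres (Inv c) (fun _ h _ hβ => Inv_refl h hβ) w hw v).1 hv

lemma Inv_ω₁ : Inv (4 / 3) ω₁ := by
  rw [ω₁_eq]
  refine ⟨fun α hα => ?_, 0, by simp [mk]; norm_num⟩
  obtain ⟨r, hr, rfl⟩ := root_exists hα
  obtain ⟨h5, h6, -⟩ := rt_bounds hr
  exact ⟨r 7, by rw [inner_mk, h5, h6]; push_cast; ring⟩

lemma Inv_ω₆ : Inv (2 / 3) ω₆ := by
  rw [ω₆_eq]
  refine ⟨fun α hα => ?_, 0, by simp [mk]; norm_num⟩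
  obtain ⟨r, hr, rfl⟩ := root_exists hα
  obtain ⟨h5, h6, -⟩ := rt_bounds hr
  have h1 := hr.2.2.1 4
  have h2 := hr.2.2.1 7
  obtain ⟨k, hk⟩ : ∃ k, r 4 = 2 * k - r 7 := ⟨(r 4 + r 7) / 2, by omega⟩
  exact ⟨k, by rw [inner_mk, h5, h6, hk]; push_cast; ring⟩

lemma orb_smul_iff {v x : E} (hx : x ∈ orb ((π / 2) • v)) : (π / 2)⁻¹ • x ∈ orb v := by
  have := orb_smul (π / 2)⁻¹ hx
  rwa [smul_smul, inv_mul_cancel₀ (by positivity), one_smul] at this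

lemma orb_disjoint : Disjoint (orb ((π / 2) • ω₁)) (orb ((π / 2) • ω₆)) := by
  rw [Set.disjoint_left]
  intro x h1 h6
  obtain ⟨-, m, hm⟩ := Inv_orb Inv_ω₁ (orb_smul_iff h1)
  obtain ⟨-, n, hn⟩ := Inv_orb Inv_ω₆ (orb_smul_iff h6)
  have : (3 * (n - m) : ℝ) = 2 := by linarith
  have h : 3 * (n - m) = 2 := by exact_mod_cast this
  omega

lemma C_eq_K : C = K := by
  refine Set.Subset.antisymm (convexHull_min ?_ K_convex) K_subset_C
  rintro x (⟨w, hw, rfl⟩ | ⟨w, hw, rfl⟩)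
  · exact (W_K hw _).1 ω₁_K
  · exact (W_K hw _).1 ω₆_K

/-- Lemma 3.17: ∂ₑΩ = Ext(Ω̄) = 𝒲((π/2)ω₁) ∐ 𝒲((π/2)ω₆), a disjoint union. -/
theorem extremePoints_eq_two_weyl_orbits :
    Set.extremePoints ℝ K =
      {x : E | ∃ w ∈ W, x = (w : E ≃ₗᵢ[ℝ] E) ((π / 2) • ω₁)} ∪
      {x : E | ∃ w ∈ W, x = (w : E ≃ₗᵢ[ℝ] E) ((π / 2) • ω₆)} ∧
    Disjoint {x : E | ∃ w ∈ W, x = (w : E ≃ₗᵢ[ℝ] E) ((π / 2) • ω₁)}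
      {x : E | ∃ w ∈ W, x = (w : E ≃ₗᵢ[ℝ] E) ((π / 2) • ω₆)} := by
  refine ⟨Set.Subset.antisymm ?_ ?_, orb_disjoint⟩
  · rw [← C_eq_K]
    exact extremePoints_convexHull_subset
  · rintro x (⟨w, hw, rfl⟩ | ⟨w, hw, rfl⟩)
    · exact ext_W ω₁_ext hw
    · exact ext_W ω₆_ext hw

end E6Boundary
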